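/- arXiv:1809.08662 — 2 statements merged into one kernel-verified Lean document; each statement's English description precedes it below -/
import Mathlib

section
/- (Ordering of the approximated Fisher informations for the exponential case.) For every integer K ≥ 3, define A(K) = K·(ln K)²/(K−1) − 1 and B(K) = 2·[ (K−1)·(ln K − ln(K/(K−1)))² / (2·(K−2)) + K·ln(K/(K−1)) − 1 ]. Then A(K) < B(K) and B(K) < K. -/
open Real

/-- The bound `log x ≤ √x - 1 / √x` for `1 ≤ x`, in squared form. -/
theorem mul_sq_log_le_sq_sub_one {x : ℝ} (hx : 1 ≤ x) :
    x * Real.log x ^ 2 ≤ (x - 1) ^ 2 := by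
  have hx0 : 0 < x := by linarith
  set t := Real.log x / 2 with ht
  have ht0 : 0 ≤ t := by have := Real.log_nonneg hx; positivity
  have hsinh : t ≤ Real.sinh t := Real.self_le_sinh_iff.2 ht0
  have hcosh : Real.cosh (2 * t) = (x + x⁻¹) / 2 := by
    rw [show 2 * t = Real.log x by rw [ht]; ring, Real.cosh_log hx0]
  have hsq : 4 * Real.sinh t ^ 2 = x + x⁻¹ - 2 := by
    have h₁ := Real.cosh_two_mul t
    have h₂ := Real.cosh_sq t
    linarith
  have hlog : Real.log x ^ 2 ≤ x + x⁻¹ - 2 := by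
    rw [← hsq, show Real.log x = 2 * t by rw [ht]; ring]
    nlinarith
  calc x * Real.log x ^ 2 ≤ x * (x + x⁻¹ - 2) := by gcongr
    _ = (x - 1) ^ 2 := by field_simp; ring

/-- The lower comparison, with `m = log n` and `d = log (n + 1) - log n`. -/
theorem maxima_lt_minima_maxima {n m d : ℝ} (hn : 1 < n) (hm : m ≤ n - 1)
    (hd : 1 ≤ (n + 1) * d) (hdn : n * d ≤ 1) :
    (n + 1) * (m + d) ^ 2 / n - 1 <
      2 * (n * m ^ 2 / (2 * (n - 1)) + (n + 1) * d - 1) := by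
  have hn0 : 0 < n := by linarith
  have hn1 : 0 < n - 1 := by linarith
  have hd1 : d < 1 := by nlinarith
  have hbracket : 0 ≤ 2 * n - 2 * m - d := by linarith
  have hprod := mul_nonneg (sub_nonneg.2 hd) hbracket
  have hquad : 0 < m ^ 2 + (n - 1) * (n - 2 * m - d) := by
    nlinarith [sq_nonneg (m - (n - 1)), mul_pos hn1 (sub_pos.2 hd1)]
  have key : 2 * (n * m ^ 2 / (2 * (n - 1)) + (n + 1) * d - 1) -
      ((n + 1) * (m + d) ^ 2 / n - 1) =
      (m ^ 2 + (n - 1) * (n - 2 * m - d) +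
        (n - 1) * (((n + 1) * d - 1) * (2 * n - 2 * m - d))) / (n * (n - 1)) := by
    field_simp
    ring
  rw [← sub_pos, key]
  have := mul_nonneg hn1.le hprod
  positivity

/-- The upper comparison, with `m = log n` and `d = log (n + 1) - log n`. -/
theorem minima_maxima_lt_card {n m d : ℝ} (hn : 1 < n)
    (hm : n * m ^ 2 ≤ (n - 1) ^ 2) (hdn : n * d ≤ 1) :
    2 * (n * m ^ 2 / (2 * (n - 1)) + (n + 1) * d - 1) < n + 1 := by
  have hn0 : 0 < n := by linarith
  have hn1 : 0 < n - 1 := by linarith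
  have hfrac : n * m ^ 2 / (2 * (n - 1)) ≤ (n - 1) / 2 := by
    rw [div_le_iff₀ (by positivity)]
    linarith
  have hd1 : d < 1 := by nlinarith
  linarith

/-- Ordering of the normalized approximated Fisher informations for the exponential
case: for every integer `K ≥ 3`, `A(K) < B(K)` and `B(K) < K`, where
`A(K) = K (ln K)²/(K-1) - 1` (maxima only) and
`B(K) = 2 [ (K-1)(ln K - ln(K/(K-1)))² / (2(K-2)) + K ln(K/(K-1)) - 1 ]`
(minima and maxima combined). -/
theorem approx_fisher_ordering (K : ℕ) (hK : 3 ≤ K) :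
    (K : ℝ) * Real.log (K : ℝ) ^ 2 / ((K : ℝ) - 1) - 1
        < 2 * (((K : ℝ) - 1)
              * (Real.log (K : ℝ) - Real.log ((K : ℝ) / ((K : ℝ) - 1))) ^ 2
              / (2 * ((K : ℝ) - 2))
            + (K : ℝ) * Real.log ((K : ℝ) / ((K : ℝ) - 1)) - 1)
      ∧ 2 * (((K : ℝ) - 1)
              * (Real.log (K : ℝ) - Real.log ((K : ℝ) / ((K : ℝ) - 1))) ^ 2
              / (2 * ((K : ℝ) - 2))
            + (K : ℝ) * Real.log ((K : ℝ) / ((K : ℝ) - 1)) - 1)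
        < (K : ℝ) := by
  obtain ⟨n, rfl⟩ : ∃ n : ℕ, K = n + 1 := ⟨K - 1, by omega⟩
  have hn : (1 : ℝ) < n := by exact_mod_cast (by omega : 1 < n)
  have hn0 : (0 : ℝ) < n := by linarith
  push_cast
  set x : ℝ := (n : ℝ)
  set d := Real.log ((x + 1) / x) with hd
  have hlog : Real.log (x + 1) = Real.log x + d := by
    rw [hd, Real.log_div (by positivity) (by positivity)]
    ring
  have hm : Real.log x ≤ x - 1 := Real.log_le_sub_one_of_pos hn0
  have hdn : x * d ≤ 1 := by
    have h := Real.log_le_sub_one_of_pos (show 0 < (x + 1) / x by positivity)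
    calc x * d ≤ x * ((x + 1) / x - 1) := by gcongr
      _ = 1 := by field_simp; ring
  have hd1 : 1 ≤ (x + 1) * d := by
    have h := Real.one_sub_inv_le_log_of_pos (show 0 < (x + 1) / x by positivity)
    calc 1 = (x + 1) * (1 - ((x + 1) / x)⁻¹) := by field_simp; ring
      _ ≤ (x + 1) * d := by gcongr
  rw [show x + 1 - 1 = x by ring, show x + 1 - 2 = x - 1 by ring, hlog,
    show Real.log x + d - d = Real.log x by ring]
  exact ⟨maxima_lt_minima_maxima hn hm hd1 hdn,
    minima_maxima_lt_card hn (mul_sq_log_le_sq_sub_one hn.le) hdn⟩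
end

section
/- (The extra information in the minima given the maxima is at most one sample and converges to exactly one sample.) Define, for integers K ≥ 3, A(K) = K·(ln K)²/(K−1) − 1 and B(K) = 2·[ (K−1)·(ln K − ln(K/(K−1)))² / (2·(K−2)) + K·ln(K/(K−1)) − 1 ]. Then for every integer K ≥ 3 one has B(K) − A(K) ≤ 1, and B(K) − A(K) → 1 as K → ∞. -/
open Real Filter

/-- The logarithmic increment satisfies `1 / (x + 1) ≤ log ((x + 1) / x) ≤ 1 / x`. -/
theorem log_increment_bounds {x : ℝ} (hx : 0 < x) :
    1 ≤ (x + 1) * Real.log ((x + 1) / x) ∧ x * Real.log ((x + 1) / x) ≤ 1 := by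
  have hpos : 0 < (x + 1) / x := by positivity
  constructor
  · have h := Real.one_sub_inv_le_log_of_pos hpos
    have e : 1 - ((x + 1) / x)⁻¹ = 1 / (x + 1) := by field_simp; ring
    rw [e, div_le_iff₀ (by positivity)] at h
    linarith
  · have h := Real.log_le_sub_one_of_pos hpos
    have e : (x + 1) / x - 1 = 1 / x := by field_simp; ring
    rw [e, le_div_iff₀ hx] at h
    linarith

/-- The information gap, written in terms of `x = K - 1`, `a = log x` and
`l = log ((x + 1) / x)`. -/
theorem gap_eq {x a l : ℝ} (hx : 1 < x) :
    2 * (x * a ^ 2 / (2 * (x - 1)) + (x + 1) * l - 1) - ((x + 1) * (a + l) ^ 2 / x - 1)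
      = a ^ 2 / (x * (x - 1)) + 2 * (x + 1) * l - (x + 1) / x * (2 * a * l + l ^ 2) - 1 := by
  have h1 : x - 1 ≠ 0 := by linarith
  have h0 : x ≠ 0 := by linarith
  field_simp
  ring

/-- A sufficient condition for the gap to be at most one, in which the increment of the logarithm
has been eliminated. -/
theorem gap_le_one_of_log_bound {x a l : ℝ} (hx : 1 < x)
    (hlx : x * l ≤ 1) (ha : a ≤ x) (h : a ^ 2 / (x - 1) + 2 ≤ 2 * a * (x + 1) / x) :
    a ^ 2 / (x * (x - 1)) + 2 * (x + 1) * l - (x + 1) / x * (2 * a * l + l ^ 2) - 1 ≤ 1 := by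
  have h0 : 0 < x := by linarith
  have h1 : 0 < x - 1 := by linarith
  have hc : 0 ≤ 2 * (x + 1) * (1 - a / x) := by
    have : a / x ≤ 1 := (div_le_one h0).2 ha
    have : 0 ≤ 1 - a / x := by linarith
    positivity
  have hl' : l ≤ 1 / x := by rw [le_div_iff₀ h0]; linarith
  have hm := mul_le_mul_of_nonneg_left hl' hc
  have hs : 0 ≤ (x + 1) / x * l ^ 2 := by positivity
  have hd := div_le_div_of_nonneg_right h h0.le
  have e1 : (a ^ 2 / (x - 1) + 2) / x = a ^ 2 / (x * (x - 1)) + 2 / x := by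
    field_simp
  have e2 : 2 * (x + 1) * (1 - a / x) * (1 / x) = 2 + 2 / x - 2 * a * (x + 1) / x / x := by
    field_simp
  have e3 : 2 * (x + 1) * (1 - a / x) * l = 2 * (x + 1) * l - (x + 1) / x * (2 * a * l) := by
    field_simp
  rw [e1] at hd
  rw [e2, e3] at hm
  linarith

theorem one_lt_log_three : 1 < Real.log 3 := by
  rw [Real.lt_log_iff_exp_lt (by norm_num)]
  linarith [Real.exp_one_lt_d9]

theorem log_three_le : Real.log 3 ≤ 6 / 5 := by
  have h := Real.log_le_sub_one_of_pos (x := 3 / 2) (by norm_num)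
  rw [Real.log_div (by norm_num) (by norm_num)] at h
  linarith [Real.log_two_lt_d9]

/-- The gap is at most one for every integer `n = K - 1 ≥ 2`. -/
theorem gap_le_one {n : ℕ} (hn : 2 ≤ n) :
    Real.log n ^ 2 / ((n : ℝ) * (n - 1)) + 2 * ((n : ℝ) + 1) * Real.log (((n : ℝ) + 1) / n)
      - ((n : ℝ) + 1) / n * (2 * Real.log n * Real.log (((n : ℝ) + 1) / n)
        + Real.log (((n : ℝ) + 1) / n) ^ 2) - 1 ≤ 1 := by
  have hn' : (2 : ℝ) ≤ n := by exact_mod_cast hn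
  have h0 : (0 : ℝ) < n := by linarith
  obtain ⟨hl1, hl2⟩ := log_increment_bounds h0
  have hl0 : 0 ≤ Real.log (((n : ℝ) + 1) / n) := by
    apply Real.log_nonneg
    rw [le_div_iff₀ h0]
    linarith
  have ha : Real.log n ≤ n := Real.log_le_self h0.le
  have h2 := Real.log_two_gt_d9
  have h2' := Real.log_two_lt_d9
  obtain rfl | rfl | h4 : n = 2 ∨ n = 3 ∨ 4 ≤ n := by omega
  · push_cast at *
    generalize Real.log ((2 + 1) / 2) = l at *
    generalize Real.log 2 = a at *
    nlinarith [mul_nonneg hl0 (sub_nonneg.2 h2.le), sq_nonneg (l - 1 / 2)]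
  · apply gap_le_one_of_log_bound (by linarith) hl2 ha
    have := one_lt_log_three
    have := log_three_le
    push_cast
    nlinarith
  · apply gap_le_one_of_log_bound (by linarith) hl2 ha
    have h4' : (4 : ℝ) ≤ n := by exact_mod_cast h4
    have hmono : Real.log 4 ≤ Real.log n := Real.log_le_log (by norm_num) h4'
    have htan : Real.log n - Real.log 4 ≤ n / 4 - 1 := by
      rw [← Real.log_div (by linarith) (by norm_num)]
      exact Real.log_le_sub_one_of_pos (by positivity)
    rw [Real.log_four_eq] at hmono htan
    generalize Real.log (n : ℝ) = a at *
    have h3 : a ^ 2 / ((n : ℝ) - 1) ≤ a / 2 := by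
      rw [div_le_iff₀ (by linarith)]
      nlinarith
    have h5 : 2 * a ≤ 2 * a * ((n : ℝ) + 1) / n := by
      rw [le_div_iff₀ h0]
      nlinarith
    linarith

/-- A lower bound for the gap that tends to one. -/
theorem one_sub_le_gap {x : ℝ} (hx : 1 < x) :
    1 - 2 * (2 * (Real.log x / x) + 1 / x) ≤
      Real.log x ^ 2 / (x * (x - 1)) + 2 * (x + 1) * Real.log ((x + 1) / x)
      - (x + 1) / x * (2 * Real.log x * Real.log ((x + 1) / x)
        + Real.log ((x + 1) / x) ^ 2) - 1 := by
  have h0 : 0 < x := by linarith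
  have h1 : 0 < x - 1 := by linarith
  obtain ⟨hl1, hl2⟩ := log_increment_bounds h0
  have ha : 0 < Real.log x := Real.log_pos hx
  have hl' : Real.log ((x + 1) / x) ≤ 1 / x := by rw [le_div_iff₀ h0]; linarith
  have hl0 : 0 < Real.log ((x + 1) / x) := by nlinarith
  generalize Real.log ((x + 1) / x) = l at *
  generalize Real.log x = a at *
  have hA : 0 ≤ a ^ 2 / (x * (x - 1)) := by positivity
  have hr : (x + 1) / x ≤ 2 := by rw [div_le_iff₀ h0]; linarith
  have hq : 2 * a * l + l ^ 2 ≤ 2 * (a / x) + 1 / x := by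
    have e : a / x = a * (1 / x) := by ring
    have : l ≤ 1 := by nlinarith
    rw [e]
    nlinarith
  have := mul_le_mul hr hq (by positivity) (by norm_num)
  linarith

/-- The extra (normalized, approximated) information in the minima given the maxima:
with `A(K) = K (ln K)²/(K-1) - 1` and
`B(K) = 2 [ (K-1)(ln K - ln(K/(K-1)))² / (2(K-2)) + K ln(K/(K-1)) - 1 ]`,
one has `B(K) - A(K) ≤ 1` for every integer `K ≥ 3`, and `B(K) - A(K) → 1` as `K → ∞`. -/
theorem extra_info_min_given_max
    (A B : ℕ → ℝ)
    (hA : ∀ K : ℕ, A K = (K : ℝ) * Real.log (K : ℝ) ^ 2 / ((K : ℝ) - 1) - 1)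
    (hB : ∀ K : ℕ, B K =
      2 * (((K : ℝ) - 1)
            * (Real.log (K : ℝ) - Real.log ((K : ℝ) / ((K : ℝ) - 1))) ^ 2
            / (2 * ((K : ℝ) - 2))
          + (K : ℝ) * Real.log ((K : ℝ) / ((K : ℝ) - 1)) - 1)) :
    (∀ K : ℕ, 3 ≤ K → B K - A K ≤ 1)
      ∧ Filter.Tendsto (fun K : ℕ => B K - A K) atTop (nhds 1) := by
  have key : ∀ n : ℕ, 2 ≤ n → B (n + 1) - A (n + 1) =
      Real.log n ^ 2 / ((n : ℝ) * (n - 1)) + 2 * ((n : ℝ) + 1) * Real.log (((n : ℝ) + 1) / n)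
      - ((n : ℝ) + 1) / n * (2 * Real.log n * Real.log (((n : ℝ) + 1) / n)
        + Real.log (((n : ℝ) + 1) / n) ^ 2) - 1 := by
    intro n hn
    have hn' : (2 : ℝ) ≤ n := by exact_mod_cast hn
    have hlog : Real.log ((n : ℝ) + 1) = Real.log n + Real.log (((n : ℝ) + 1) / n) := by
      rw [Real.log_div (by linarith) (by linarith)]
      ring
    rw [← gap_eq (by linarith), hA, hB]
    push_cast
    rw [add_sub_cancel_right, hlog, add_sub_cancel_right,
      show (n : ℝ) + 1 - 2 = n - 1 by ring]
  have upper : ∀ K : ℕ, 3 ≤ K → B K - A K ≤ 1 := by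
    intro K hK
    obtain ⟨n, rfl⟩ : ∃ n, K = n + 1 := ⟨K - 1, by omega⟩
    rw [key n (by omega)]
    exact gap_le_one (by omega)
  refine ⟨upper, ?_⟩
  rw [← tendsto_add_atTop_iff_nat 1]
  have hlog : Tendsto (fun n : ℕ => Real.log n / n) atTop (nhds 0) :=
    (Real.isLittleO_log_id_atTop.tendsto_div_nhds_zero).comp tendsto_natCast_atTop_atTop
  have hlower : Tendsto (fun n : ℕ => 1 - 2 * (2 * (Real.log n / n) + 1 / (n : ℝ)))
      atTop (nhds 1) := by
    simpa using
      (((hlog.const_mul 2).add tendsto_one_div_atTop_nhds_zero_nat).const_mul 2).const_sub 1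
  refine tendsto_of_tendsto_of_tendsto_of_le_of_le' hlower tendsto_const_nhds ?_ ?_
  · filter_upwards [eventually_ge_atTop 2] with n hn
    rw [key n hn]
    exact one_sub_le_gap (by exact_mod_cast hn)
  · filter_upwards [eventually_ge_atTop 2] with n hn
    exact upper (n + 1) (by omega)
end
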